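/- Let φ : X → Y be a morphism of schemes of finite type over a field that is locally of finite type. Then for each integer d, the set of points x ∈ X such that the local dimension at x of the fiber φ^{-1}(φ(x)) is at least d is closed in X. -/

import Mathlib

open AlgebraicGeometry

/-- The local dimension of a topological space at a point: the infimum over open
neighborhoods `U` of `x` of the Krull dimension of `U`. -/
noncomputable def localDim (T : Type*) [TopologicalSpace T] (x : T) : WithBot ℕ∞ :=
  ⨅ (U : Set T) (_ : IsOpen U) (_ : x ∈ U), topologicalKrullDim U

theorem topologicalKrullDim_le_of_fiber_specializes {X Y : Type*} [TopologicalSpace X]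
    [TopologicalSpace Y] [QuasiSober X] [T0Space Y] {f : X → Y} (hf : Continuous f)
    (h : ∀ x y, x ⤳ y → f x = f y → x = y) :
    topologicalKrullDim X ≤ topologicalKrullDim Y := by
  refine Order.krullDim_le_of_strictMono (TopologicalSpace.IrreducibleCloseds.map f hf) ?_
  have hmono : Monotone (TopologicalSpace.IrreducibleCloseds.map f hf) :=
    fun Z W hZW => closure_mono (Set.image_mono hZW)
  refine fun Z W hZW => lt_of_le_of_ne (hmono hZW.le) fun heq => hZW.ne ?_
  obtain ⟨z, hz⟩ := QuasiSober.sober Z.isIrreducible Z.isClosed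
  obtain ⟨w, hw⟩ := QuasiSober.sober W.isIrreducible W.isClosed
  have hzw : z = w := (h w z (hw.specializes (hZW.le hz.mem)) <|
    (hw.image hf).eq <| by
      have := congrArg (fun V : TopologicalSpace.IrreducibleCloseds Y => (V : Set Y)) heq
      change closure (f '' Z) = closure (f '' W) at this
      exact this ▸ hz.image hf).symm
  subst hzw
  exact TopologicalSpace.IrreducibleCloseds.ext (hz.def.symm.trans hw.def)

theorem ringKrullDim_le_of_isIntegral_of_injective {A B : Type*} [CommRing A] [CommRing B]
    [Algebra A B] [Algebra.IsIntegral A B] (h : Function.Injective (algebraMap A B)) :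
    ringKrullDim A ≤ ringKrullDim B := by
  refine iSup_le fun l => ?_
  have : FaithfulSMul A B := (faithfulSMul_iff_algebraMap_injective A B).mpr h
  obtain ⟨P, hP⟩ := Algebra.IsIntegral.comap_surjective A B l.head
  have : P.asIdeal.LiesOver l.head.asIdeal := ⟨congrArg PrimeSpectrum.asIdeal hP.symm⟩
  obtain ⟨L, hL, -, -⟩ := Ideal.exists_ltSeries_of_hasGoingUp l P.asIdeal
  exact hL ▸ Order.LTSeries.length_le_krullDim L

namespace PrimeSpectrum

theorem topologicalKrullDim_comap_preimage {R S : Type*} [CommRing R] [CommRing S] [Algebra R S]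
    (p : PrimeSpectrum R) :
    topologicalKrullDim (comap (algebraMap R S) ⁻¹' {p}) = ringKrullDim (p.asIdeal.Fiber S) :=
  (preimageHomeomorphFiber R S p).isHomeomorph.topologicalKrullDim_eq.trans
    (topologicalKrullDim_eq_ringKrullDim _)

theorem topologicalKrullDim_comap_preimage_mvPolynomial {R σ : Type*} [CommRing R] [Finite σ]
    (p : PrimeSpectrum R) :
    topologicalKrullDim (comap (algebraMap R (MvPolynomial σ R)) ⁻¹' {p}) = Nat.card σ := by
  rw [topologicalKrullDim_comap_preimage, ringKrullDim_eq_of_ringEquiv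
    (MvPolynomial.algebraTensorAlgEquiv R p.asIdeal.ResidueField).toRingEquiv]
  simp

theorem comap_algebraMap_comap {R A S : Type*} [CommRing R] [CommRing A] [CommRing S]
    [Algebra R A] [Algebra R S] [Algebra A S] [IsScalarTower R A S] (q : PrimeSpectrum S) :
    comap (algebraMap R A) (comap (algebraMap A S) q) = comap (algebraMap R S) q := by
  rw [IsScalarTower.algebraMap_eq R A S, comap_comp]
  rfl

theorem topologicalKrullDim_comap_preimage_inter_le {R A S : Type*} [CommRing R] [CommRing A]
    [CommRing S] [Algebra R A] [Algebra R S] [Algebra A S] [IsScalarTower R A S]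
    (p : PrimeSpectrum R) (U : TopologicalSpace.Opens (PrimeSpectrum S))
    (hU : ∀ q ∈ U, Algebra.QuasiFiniteAt A q.asIdeal) :
    topologicalKrullDim ↥(comap (algebraMap R S) ⁻¹' {p} ∩ U) ≤
      topologicalKrullDim (comap (algebraMap R A) ⁻¹' {p}) := by
  have : QuasiSober (comap (algebraMap R S) ⁻¹' {p}) :=
    (preimageHomeomorphFiber R S p).isOpenEmbedding.quasiSober
  have hι : Topology.IsOpenEmbedding
      (Set.inclusion (Set.inter_subset_left : comap (algebraMap R S) ⁻¹' {p} ∩ U ⊆ _)) := by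
    refine ⟨.inclusion _, ?_⟩
    rw [Set.range_inclusion]
    convert U.isOpen.preimage continuous_subtype_val using 1
    ext q
    exact ⟨fun h => h.2, fun h => ⟨q.2, h⟩⟩
  have := hι.quasiSober
  refine topologicalKrullDim_le_of_fiber_specializes
    (f := fun q => ⟨comap (algebraMap A S) q.1, (comap_algebraMap_comap q.1).trans q.2.1⟩)
    (by fun_prop) ?_
  rintro ⟨q, hqp, hq⟩ ⟨q', hqp', hq'⟩ hs heq
  have hs : q ⤳ q' := Specializes.map hs continuous_subtype_val
  have := hU q' hq'
  exact Subtype.ext <| PrimeSpectrum.ext <| Algebra.QuasiFiniteAt.eq_of_le_of_under_eq (R := A)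
    ((le_iff_specializes _ _).mpr hs) (congrArg (fun x => x.1.asIdeal) heq)

end PrimeSpectrum

theorem Algebra.exists_notMem_forall_quasiFiniteAt {A S : Type*} [CommRing A] [CommRing S]
    [Algebra A S] [Algebra.FiniteType A S] (q : Ideal S) [q.IsPrime] [Algebra.QuasiFiniteAt A q] :
    ∃ r ∉ q, ∀ (q' : Ideal S) [q'.IsPrime], r ∉ q' → Algebra.QuasiFiniteAt A q' := by
  obtain ⟨r, hr, H⟩ := Algebra.zariskisMainProperty_iff'.mp (.of_finiteType (R := A) q)
  exact ⟨r, hr, fun q' _ hq' => (Algebra.zariskisMainProperty_iff'.mpr ⟨r, hq', H⟩).quasiFiniteAt⟩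

theorem MvPolynomial.quasiFinite_map_algebraMap {R K σ : Type*} [CommRing R] [CommRing K]
    [Algebra R K] [Algebra.QuasiFinite R K] :
    (MvPolynomial.map (σ := σ) (algebraMap R K)).QuasiFinite := by
  let := MvPolynomial.algebraMvPolynomial (R := R) (S := K) (σ := σ)
  have e := Algebra.IsPushout.equiv R (MvPolynomial σ R) K (MvPolynomial σ K)
  exact (Algebra.QuasiFinite.iff_of_algEquiv e).mp inferInstance

open Algebra.TensorProduct in
theorem Algebra.FiniteType.exists_mvPolynomial_quasiFinite_fiber {R S : Type*} [CommRing R]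
    [CommRing S] [Algebra R S] [Algebra.FiniteType R S] (p : Ideal R) [p.IsPrime]
    [Nontrivial (p.Fiber S)] :
    ∃ (s : ℕ) (φ : MvPolynomial (Fin s) R →ₐ[R] S), s ≤ ringKrullDim (p.Fiber S) ∧
      ((includeRight : S →ₐ[R] p.Fiber S).comp φ).toRingHom.QuasiFinite := by
  obtain ⟨s, g, hg, hfin⟩ := exists_finite_inj_algHom_of_fg p.ResidueField (p.Fiber S)
  choose r hr a ha using fun i =>
    Ideal.Fiber.exists_smul_eq_one_tmul (p := p) (g (MvPolynomial.X i))
  refine ⟨s, MvPolynomial.aeval a, ?_, ?_⟩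
  · let := g.toRingHom.toAlgebra
    have : Module.Finite (MvPolynomial (Fin s) p.ResidueField) (p.Fiber S) := hfin
    simpa using ringKrullDim_le_of_isIntegral_of_injective
      (A := MvPolynomial (Fin s) p.ResidueField) (B := p.Fiber S) hg
  · have hr' (i) : algebraMap R p.ResidueField (r i) ≠ 0 := by simpa using hr i
    let scale : MvPolynomial (Fin s) p.ResidueField →ₐ[p.ResidueField] _ :=
      MvPolynomial.aeval fun i =>
        MvPolynomial.C (algebraMap R p.ResidueField (r i)) * MvPolynomial.X i
    have hscale : Function.Surjective scale := by
      rw [← AlgHom.range_eq_top, ← top_le_iff, ← MvPolynomial.adjoin_range_X,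
        Algebra.adjoin_le_iff]
      rintro _ ⟨i, rfl⟩
      refine ⟨MvPolynomial.C (algebraMap R p.ResidueField (r i))⁻¹ * MvPolynomial.X i, ?_⟩
      rw [AlgHom.toRingHom_eq_coe, RingHom.coe_coe, map_mul, MvPolynomial.aeval_X,
        MvPolynomial.algHom_C, MvPolynomial.algebraMap_eq, ← mul_assoc, ← MvPolynomial.C_mul,
        inv_mul_cancel₀ (hr' i), MvPolynomial.C_1, one_mul]
    have heq : ((includeRight : S →ₐ[R] p.Fiber S).comp (MvPolynomial.aeval a)).toRingHom =
        (g.comp scale).toRingHom.comp (MvPolynomial.map (algebraMap R p.ResidueField)) := by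
      refine MvPolynomial.ringHom_ext (fun x => ?_) fun i => ?_
      · simp [scale]
      · simpa [scale, Algebra.smul_def,
          IsScalarTower.algebraMap_apply R p.ResidueField (p.Fiber S)] using (ha i).symm
    rw [heq]
    exact (RingHom.QuasiFinite.of_finite (hfin.comp (RingHom.Finite.of_surjective _ hscale))).comp
      MvPolynomial.quasiFinite_map_algebraMap

open PrimeSpectrum in
theorem Algebra.QuasiFiniteAt.of_quasiFinite_fiber {R A S : Type*} [CommRing R] [CommRing A]
    [CommRing S] [Algebra R A] [Algebra R S] [Algebra A S] [IsScalarTower R A S]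
    [Algebra.FiniteType A S] (q : PrimeSpectrum S)
    (h : ((Algebra.TensorProduct.includeRight :
      S →ₐ[R] (comap (algebraMap R S) q).asIdeal.Fiber S).toRingHom.comp
        (algebraMap A S)).QuasiFinite) :
    Algebra.QuasiFiniteAt A q.asIdeal := by
  set p := comap (algebraMap R S) q
  let e := preimageHomeomorphFiber R S p
  have hsub : comap (algebraMap A S) ⁻¹' {comap (algebraMap A S) q} ⊆
      comap (algebraMap R S) ⁻¹' {p} := fun x hx => by
    simp only [Set.mem_preimage, Set.mem_singleton_iff] at hx ⊢
    rw [← comap_algebraMap_comap (A := A), hx, comap_algebraMap_comap]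
  let j := e ∘ Set.inclusion hsub
  have hj : Topology.IsEmbedding j := e.isEmbedding.comp (.inclusion hsub)
  algebraize [((Algebra.TensorProduct.includeRight :
      S →ₐ[R] p.asIdeal.Fiber S).toRingHom.comp (algebraMap A S))]
  have hd := Algebra.QuasiFinite.isDiscrete_comap_preimage_singleton (R := A)
    (S := p.asIdeal.Fiber S) (comap (algebraMap A S) q)
  have hjmem (x) : j x ∈
      comap (algebraMap A (p.asIdeal.Fiber S)) ⁻¹' {comap (algebraMap A S) q} := by
    refine Eq.trans ?_ x.2
    exact congrArg (fun y => comap (algebraMap A S) y.1) (e.symm_apply_apply (Set.inclusion hsub x))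
  have := hd.to_subtype
  have : DiscreteTopology (comap (algebraMap A S) ⁻¹' {comap (algebraMap A S) q}) :=
    (hj.codRestrict _ hjmem).discreteTopology
  exact .of_isOpen_singleton_fiber q (isOpen_discrete _)

open PrimeSpectrum in
theorem PrimeSpectrum.exists_topologicalKrullDim_comap_preimage_inter_basicOpen_le {R S : Type*}
    [CommRing R] [CommRing S] [Algebra R S] [Algebra.FiniteType R S] (q : PrimeSpectrum S) :
    ∃ r ∉ q.asIdeal, ∀ p : PrimeSpectrum R,
      topologicalKrullDim ↥(comap (algebraMap R S) ⁻¹' {p} ∩ basicOpen r) ≤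
        topologicalKrullDim (comap (algebraMap R S) ⁻¹' {comap (algebraMap R S) q}) := by
  set p := comap (algebraMap R S) q
  have : Nonempty (PrimeSpectrum (p.asIdeal.Fiber S)) :=
    ⟨preimageHomeomorphFiber R S p ⟨q, rfl⟩⟩
  have : Nontrivial (p.asIdeal.Fiber S) := PrimeSpectrum.nonempty_iff_nontrivial.mp this
  obtain ⟨s, φ, hs, hφ⟩ := Algebra.FiniteType.exists_mvPolynomial_quasiFinite_fiber (S := S)
    p.asIdeal
  let := φ.toRingHom.toAlgebra
  have : IsScalarTower R (MvPolynomial (Fin s) R) S := .of_algebraMap_eq' φ.comp_algebraMap.symm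
  have : Algebra.FiniteType (MvPolynomial (Fin s) R) S := .of_restrictScalars_finiteType R _ _
  have := Algebra.QuasiFiniteAt.of_quasiFinite_fiber (R := R) (A := MvPolynomial (Fin s) R) q hφ
  obtain ⟨r, hr, H⟩ :=
    Algebra.exists_notMem_forall_quasiFiniteAt (A := MvPolynomial (Fin s) R) q.asIdeal
  refine ⟨r, hr, fun p' => ?_⟩
  refine (topologicalKrullDim_comap_preimage_inter_le (A := MvPolynomial (Fin s) R) p' (basicOpen r)
    fun q' hq' => H _ hq').trans ?_
  rw [topologicalKrullDim_comap_preimage_mvPolynomial, topologicalKrullDim_comap_preimage]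
  simpa using hs

theorem localDim_le_topologicalKrullDim {T : Type*} [TopologicalSpace T] {U : Set T} {x : T}
    (hU : IsOpen U) (hx : x ∈ U) : localDim T x ≤ topologicalKrullDim U :=
  iInf₂_le_of_le U hU (iInf_le _ hx)

theorem topologicalKrullDim_mono {T : Type*} [TopologicalSpace T] {A B : Set T} (h : A ⊆ B) :
    topologicalKrullDim A ≤ topologicalKrullDim B :=
  (Topology.IsEmbedding.inclusion h).isInducing.topologicalKrullDim_le

theorem topologicalKrullDim_preimage_val {T : Type*} [TopologicalSpace T] (A B : Set T) :
    topologicalKrullDim ((↑) ⁻¹' B : Set A) = topologicalKrullDim ↥(A ∩ B) := by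
  rw [← Subtype.image_preimage_coe]
  exact (Topology.IsEmbedding.subtypeVal.homeomorphImage _).isHomeomorph.topologicalKrullDim_eq

theorem isClosed_setOf_le_localDim_fiber {X Y : Type*} [TopologicalSpace X] {f : X → Y}
    (h : ∀ (x : X) (U : Set X), IsOpen U → x ∈ U → ∃ V, IsOpen V ∧ x ∈ V ∧ ∀ y ∈ V,
      topologicalKrullDim ↥(f ⁻¹' {f y} ∩ V) ≤ topologicalKrullDim ↥(f ⁻¹' {f x} ∩ U))
    (d : WithBot ℕ∞) : IsClosed {x | d ≤ localDim (f ⁻¹' {f x}) ⟨x, rfl⟩} := by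
  rw [← isOpen_compl_iff, isOpen_iff_forall_mem_open]
  intro x hx
  simp only [Set.mem_compl_iff, Set.mem_ofPred_eq, not_le, localDim, iInf_lt_iff] at hx
  obtain ⟨_, ⟨U, hU, rfl⟩, hxU, hdim⟩ := hx
  obtain ⟨V, hV, hxV, H⟩ := h x U hU hxU
  refine ⟨V, fun y hy => not_le.mpr (lt_of_le_of_lt ?_ hdim), hV, hxV⟩
  refine (localDim_le_topologicalKrullDim (hV.preimage continuous_subtype_val) hy).trans ?_
  rw [topologicalKrullDim_preimage_val, topologicalKrullDim_preimage_val]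
  exact H y hy

theorem Topology.IsEmbedding.topologicalKrullDim_fiber_inter_image {X Y X' Y' : Type*}
    [TopologicalSpace X] [TopologicalSpace X'] {f : X → Y} {f' : X' → Y'} {i : X' → X} {j : Y' → Y}
    (hi : Topology.IsEmbedding i) (hj : Function.Injective j) (h : ∀ x, f (i x) = j (f' x))
    (A : Set X') (x : X') :
    topologicalKrullDim ↥(f ⁻¹' {f (i x)} ∩ i '' A) = topologicalKrullDim ↥(f' ⁻¹' {f' x} ∩ A) := by
  have : f ⁻¹' {f (i x)} ∩ i '' A = i '' (f' ⁻¹' {f' x} ∩ A) := by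
    ext y
    constructor
    · rintro ⟨hy, z, hz, rfl⟩
      exact ⟨z, ⟨hj (by simpa [h] using hy), hz⟩, rfl⟩
    · rintro ⟨z, ⟨hz, hzA⟩, rfl⟩
      exact ⟨by simpa [h] using congrArg j hz, z, hzA, rfl⟩
  rw [this, (hi.homeomorphImage _).isHomeomorph.topologicalKrullDim_eq]

/-- Upper semicontinuity of fiber dimension on the source: for a morphism `f : X ⟶ Y` of
schemes of finite type over a field `k` that is locally of finite type, and any integer
`d`, the set of points `x ∈ X` where the local dimension at `x` of the fiber
`f⁻¹(f(x))` is at least `d` is closed in `X`. -/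
theorem stmt19 {k : Type*} [Field k] (X Y : Scheme)
    (sX : X ⟶ Spec (CommRingCat.of k)) (sY : Y ⟶ Spec (CommRingCat.of k))
    [LocallyOfFiniteType sX] [QuasiCompact sX]
    [LocallyOfFiniteType sY] [QuasiCompact sY]
    (f : X ⟶ Y) [LocallyOfFiniteType f] (d : ℕ) :
    IsClosed {x : X | (d : WithBot ℕ∞) ≤
      localDim (f.base ⁻¹' {f.base x} : Set X) ⟨x, rfl⟩} := by
  refine isClosed_setOf_le_localDim_fiber (fun x U hU hxU => ?_) _
  obtain ⟨W, hW, hxW, -⟩ := exists_isAffineOpen_mem_and_subset (X := Y) (x := f x) (U := ⊤) trivial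
  obtain ⟨V, hV, hxV, hVU⟩ := exists_isAffineOpen_mem_and_subset (X := X) (x := x)
    (U := ⟨U, hU⟩ ⊓ f ⁻¹ᵁ W) ⟨hxU, hxW⟩
  have e : V ≤ f ⁻¹ᵁ W := fun y hy => (hVU hy).2
  let := (f.appLE W V e).hom.toAlgebra
  have : Algebra.FiniteType Γ(Y, W) Γ(X, V) := f.finiteType_appLE hW hV e
  let i : PrimeSpectrum Γ(X, V) → X := hV.fromSpec
  let j : PrimeSpectrum Γ(Y, W) → Y := hW.fromSpec
  have hcomm (q) : f.base (i q) = j (PrimeSpectrum.comap (algebraMap Γ(Y, W) Γ(X, V)) q) :=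
    (congrArg (fun g => g.base q) (IsAffineOpen.SpecMap_appLE_fromSpec f hW hV e)).symm
  have hi : Topology.IsOpenEmbedding i := hV.fromSpec.isOpenEmbedding
  have hj : Function.Injective j := hW.fromSpec.isOpenEmbedding.injective
  have hrange : Set.range i = V := hV.range_fromSpec
  obtain ⟨q, rfl⟩ : x ∈ Set.range i := hrange ▸ hxV
  obtain ⟨r, hr, H⟩ :=
    PrimeSpectrum.exists_topologicalKrullDim_comap_preimage_inter_basicOpen_le (R := Γ(Y, W)) q
  refine ⟨i '' PrimeSpectrum.basicOpen r, hi.isOpenMap _ (PrimeSpectrum.basicOpen r).isOpen,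
    ⟨q, hr, rfl⟩, ?_⟩
  rintro _ ⟨q', -, rfl⟩
  have hVU' : i '' Set.univ ⊆ U := by
    rw [Set.image_univ, hrange]
    exact fun y hy => (hVU hy).1
  refine le_trans ?_ (topologicalKrullDim_mono (Set.inter_subset_inter_right _ hVU'))
  rw [hi.isEmbedding.topologicalKrullDim_fiber_inter_image hj hcomm,
    hi.isEmbedding.topologicalKrullDim_fiber_inter_image hj hcomm, Set.inter_univ]
  exact H _
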